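/- Let G=(V,E) be a finite connected graph, let L be a laminar family of nonempty subsets of V, let x be a point of the spanning tree polytope of G, and let η > 2 be a real number. Then there exist a laminar family L' of nonempty subsets of V and a point x' of the spanning tree polytope of G such that: (i) x' is L'-aligned, i.e., for every S ∈ L' the restriction of x' to E(S) lies in the spanning tree polytope of G[S]; (ii) x'(e) ≤ η·x(e) for every e ∈ E; and (iii) for every spanning tree T of G and all reals α, β ≥ 0, if |T ∩ δ(S)| ≤ α·x'(δ(S)) + β for all S ∈ L', then |T ∩ δ(S)| ≤ (1/(1−2/η))·(η·α + β)·x(δ(S)) for all S ∈ L. -/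

import Mathlib

open scoped Classical
open Finset

noncomputable section

variable {V : Type}

/-- The set of edges of `G` with exactly one endpoint in `S`. -/
def cutEdges [Fintype V] (G : SimpleGraph V) (S : Set V) : Finset (Sym2 V) :=
  Finset.univ.filter (fun e => e ∈ G.edgeSet ∧ ∃ u v, e = s(u, v) ∧ u ∈ S ∧ v ∉ S)

/-- The set of edges of `G` with both endpoints in `S`. -/
def insideEdges [Fintype V] (G : SimpleGraph V) (S : Set V) : Finset (Sym2 V) :=
  Finset.univ.filter (fun e => e ∈ G.edgeSet ∧ ∀ v ∈ e, v ∈ S)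

/-- A family of sets is laminar if any two members are disjoint or nested. -/
def Laminar (L : Set (Set V)) : Prop :=
  ∀ S T, S ∈ L → T ∈ L → S ∩ T = ∅ ∨ S ∩ T = S ∨ S ∩ T = T

/-- The spanning tree polytope of `G` : the convex hull of the indicator vectors of
the edge sets of spanning trees of `G`. -/
def stPolytope [Fintype V] (G : SimpleGraph V) : Set (Sym2 V → ℝ) :=
  convexHull ℝ { y | ∃ T : SimpleGraph V, T ≤ G ∧ T.IsTree ∧
      y = fun e => if e ∈ T.edgeSet then (1 : ℝ) else 0 }

/-- `x` is `L`-aligned: for every `S ∈ L`, the restriction of `x` to `E(S)` lies in the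
spanning tree polytope of the induced subgraph `G[S]`. -/
def IsAligned [Fintype V] (G : SimpleGraph V) (L : Set (Set V)) (x : Sym2 V → ℝ) : Prop :=
  ∀ S ∈ L, (fun e : Sym2 S => x (e.map Subtype.val)) ∈ stPolytope (G.induce S)

/-- The edges of `F` whose endpoints receive different labels under `p`. -/
def crossing {ι : Type*} (F : Finset (Sym2 V)) (p : V → ι) : Finset (Sym2 V) :=
  F.filter (fun e => ¬ (e.map p).IsDiag)

/-- The edges of `T`, as a finset. -/
def graphEdges [Fintype V] (T : SimpleGraph V) : Finset (Sym2 V) :=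
  Finset.univ.filter (fun e => e ∈ T.edgeSet)

lemma mem_graphEdges [Fintype V] {T : SimpleGraph V} {e : Sym2 V} :
    e ∈ graphEdges T ↔ e ∈ T.edgeSet := by
  simp [graphEdges]

/-- The weights `w` are strong on `S` if every partition of `S` into `k` classes, given by a
labelling of the vertices, has crossing weight at least `k - 1`. -/
def IsStrong [Fintype V] (G : SimpleGraph V) (w : Sym2 V → ℝ) (S : Set V) : Prop :=
  ∀ p : V → V, ((p '' S).ncard : ℝ) ≤ ∑ e ∈ crossing (insideEdges G S) p, w e + 1

lemma mem_crossing {ι : Type*} {F : Finset (Sym2 V)} {p : V → ι} {e : Sym2 V} :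
    e ∈ crossing F p ↔ e ∈ F ∧ ¬ (e.map p).IsDiag := by
  simp [crossing]

lemma mk_mem_insideEdges [Fintype V] {G : SimpleGraph V} {S : Set V} {a b : V} :
    s(a, b) ∈ insideEdges G S ↔ G.Adj a b ∧ a ∈ S ∧ b ∈ S := by
  simp [insideEdges]

lemma mem_edgeSet_of_mem_insideEdges [Fintype V] {G : SimpleGraph V} {S : Set V} {e : Sym2 V}
    (he : e ∈ insideEdges G S) : e ∈ G.edgeSet := by
  simp only [insideEdges, mem_filter] at he
  exact he.2.1

lemma mk_mem_cutEdges [Fintype V] {G : SimpleGraph V} {S : Set V} {a b : V} :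
    s(a, b) ∈ cutEdges G S ↔ G.Adj a b ∧ ((a ∈ S ∧ b ∉ S) ∨ (b ∈ S ∧ a ∉ S)) := by
  simp only [cutEdges, mem_filter, mem_univ, true_and, SimpleGraph.mem_edgeSet, Sym2.eq_iff]
  constructor
  · rintro ⟨h, u, v, (⟨rfl, rfl⟩ | ⟨rfl, rfl⟩), hu, hv⟩ <;> tauto
  · rintro ⟨h, (h' | h')⟩
    · exact ⟨h, a, b, by tauto⟩
    · exact ⟨h, b, a, by tauto⟩

lemma mem_edgeSet_of_mem_cutEdges [Fintype V] {G : SimpleGraph V} {S : Set V} {e : Sym2 V}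
    (he : e ∈ cutEdges G S) : e ∈ G.edgeSet := by
  simp only [cutEdges, mem_filter] at he
  exact he.2.1

lemma exists_relabelling [Finite V] {ι : Type*} (p : V → ι) (S : Set V) :
    ∃ q : V → V, (q '' S).ncard = (p '' S).ncard ∧
      ∀ F : Finset (Sym2 V), crossing F q = crossing F p := by
  obtain ⟨q, hq⟩ : ∃ q : V → V, ∀ a b, q a = q b ↔ p a = p b := by
    rcases isEmpty_or_nonempty V with hV | hV
    · exact ⟨id, fun a => hV.elim a⟩
    · have hinv : ∀ v, p (Function.invFun p (p v)) = p v := fun v =>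
        Function.invFun_eq ⟨v, rfl⟩
      refine ⟨Function.invFun p ∘ p, fun a b => ⟨fun hab => ?_, fun hab => ?_⟩⟩
      · rw [← hinv a, ← hinv b]
        exact congrArg p hab
      · exact congrArg (Function.invFun p) hab
  refine ⟨q, ?_, fun F => ?_⟩
  · refine Set.ncard_congr' (Equiv.ofBijective
      (fun x => ⟨p x.2.choose, x.2.choose, x.2.choose_spec.1, rfl⟩) ⟨?_, ?_⟩)
    · intro x y hxy
      have h := (hq _ _).2 (Subtype.ext_iff.1 hxy)
      rw [x.2.choose_spec.2, y.2.choose_spec.2] at h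
      exact Subtype.ext h
    · rintro ⟨_, v, hv, rfl⟩
      have hx : q v ∈ q '' S := ⟨v, hv, rfl⟩
      exact ⟨⟨q v, hx⟩, Subtype.ext ((hq _ _).1 hx.choose_spec.2)⟩
  · ext e
    induction e using Sym2.ind with
    | _ a b => simp [mem_crossing, hq]

lemma IsStrong.ncard_image_le [Fintype V] {G : SimpleGraph V} {w : Sym2 V → ℝ} {S : Set V}
    (h : IsStrong G w S) {ι : Type*} (p : V → ι) :
    ((p '' S).ncard : ℝ) ≤ ∑ e ∈ crossing (insideEdges G S) p, w e + 1 := by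
  obtain ⟨q, hq, hc⟩ := exists_relabelling p S
  simpa only [hq, hc] using h q

/-- A coarsest partition of `S` minimizing crossing weight minus number of classes. -/
lemma exists_strong_partition [Fintype V] (G : SimpleGraph V) (w : Sym2 V → ℝ)
    (hw : ∀ e ∈ G.edgeSet, 0 ≤ w e) (S : Set V) (hS : S.Nonempty) :
    ∃ p : V → V,
      (∑ e ∈ crossing (insideEdges G S) p, w e + 1 ≤ ((p '' S).ncard : ℝ)) ∧
      (∀ i ∈ p '' S, IsStrong G w (S ∩ p ⁻¹' {i})) ∧
      (∀ W ⊆ S, IsStrong G w W → ∀ a ∈ W, ∀ b ∈ W, p a = p b) := by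
  obtain ⟨s₀, hs₀⟩ := hS
  have : Nonempty V := ⟨s₀⟩
  have hwS : ∀ {W : Set V} {e}, e ∈ insideEdges G W → 0 ≤ w e := fun he =>
    hw _ (mem_edgeSet_of_mem_insideEdges he)
  let f : (V → V) → ℝ := fun p =>
    ∑ e ∈ crossing (insideEdges G S) p, w e - ((p '' S).ncard : ℝ)
  obtain ⟨p, hp⟩ := Finite.exists_min
    (fun p : V → V => (toLex (f p, (p '' S).ncard) : ℝ ×ₗ ℕ))
  have hmin : ∀ q, f p < f q ∨ f p = f q ∧ (p '' S).ncard ≤ (q '' S).ncard := fun q => by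
    simpa [Prod.Lex.le_iff] using hp q
  have hle : ∀ q, f p ≤ f q := fun q => (hmin q).elim le_of_lt (fun h => h.1.le)
  have hgen : ∀ {ι : Type} (q : V → ι),
      f p ≤ ∑ e ∈ crossing (insideEdges G S) q, w e - ((q '' S).ncard : ℝ) := by
    intro ι q
    obtain ⟨r, hr, hc⟩ := exists_relabelling q S
    simpa only [f, hr, hc] using hle r
  refine ⟨p, ?_, ?_, ?_⟩
  · have h1 := hgen (fun _ => ())
    have h2 : crossing (insideEdges G S) (fun _ : V => ()) = ∅ := by
      ext e
      induction e using Sym2.ind with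
      | _ a b => simp [mem_crossing]
    have h3 : ((fun _ : V => ()) '' S).ncard = 1 := by
      rw [Set.Nonempty.image_const ⟨s₀, hs₀⟩, Set.ncard_singleton]
    rw [h2, h3] at h1
    simp only [f, Finset.sum_empty, Nat.cast_one] at h1
    linarith
  · intro i hi q
    let P : V → V ⊕ V := fun v => if p v = i then Sum.inr (q v) else Sum.inl (p v)
    have h1 := hgen P
    have himg : P '' S = Sum.inl '' (p '' S \ {i}) ∪ Sum.inr '' (q '' (S ∩ p ⁻¹' {i})) := by
      ext x
      constructor
      · rintro ⟨v, hv, rfl⟩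
        by_cases h : p v = i
        · right
          exact ⟨q v, ⟨v, ⟨hv, h⟩, rfl⟩, by simp [P, h]⟩
        · left
          exact ⟨p v, ⟨⟨v, hv, rfl⟩, h⟩, by simp [P, h]⟩
      · rintro (⟨_, ⟨⟨v, hv, rfl⟩, h⟩, rfl⟩ | ⟨_, ⟨v, ⟨hv, h⟩, rfl⟩, rfl⟩)
        · exact ⟨v, hv, by simp_all [P]⟩
        · exact ⟨v, hv, by simp_all [P]⟩
    have hcard : (P '' S).ncard + 1 = (p '' S).ncard + (q '' (S ∩ p ⁻¹' {i})).ncard := by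
      rw [himg, Set.ncard_union_eq, Set.ncard_image_of_injective _ Sum.inl_injective,
        Set.ncard_image_of_injective _ Sum.inr_injective]
      · have := Set.ncard_sdiff_singleton_add_one hi
        omega
      · rw [Set.disjoint_left]
        rintro _ ⟨a, -, rfl⟩ ⟨b, -, hb⟩
        cases hb
    have hsub : crossing (insideEdges G S) P ⊆ crossing (insideEdges G S) p ∪
        crossing (insideEdges G (S ∩ p ⁻¹' {i})) q := by
      intro e
      induction e using Sym2.ind with
      | _ a b =>
        simp only [mem_crossing, mem_union, mk_mem_insideEdges, Sym2.map_mk, Sym2.mk_isDiag_iff,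
          Set.mem_inter_iff, Set.mem_preimage, Set.mem_singleton_iff, P]
        rintro ⟨⟨hab, ha, hb⟩, hne⟩
        by_cases hpa : p a = i <;> by_cases hpb : p b = i <;> simp_all
        · exact Ne.symm hpb
    have hsum : ∑ e ∈ crossing (insideEdges G S) P, w e ≤
        ∑ e ∈ crossing (insideEdges G S) p, w e +
        ∑ e ∈ crossing (insideEdges G (S ∩ p ⁻¹' {i})) q, w e := by
      have hnn : ∀ e ∈ crossing (insideEdges G S) p ∪
          crossing (insideEdges G (S ∩ p ⁻¹' {i})) q, 0 ≤ w e := by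
        intro e he
        rcases mem_union.1 he with he | he <;> exact hwS (mem_crossing.1 he).1
      refine (Finset.sum_le_sum_of_subset_of_nonneg hsub fun e he _ => hnn e he).trans ?_
      rw [← Finset.sum_union_inter]
      refine le_add_of_nonneg_right (Finset.sum_nonneg fun e he => ?_)
      exact hwS (mem_crossing.1 (mem_inter.1 he).1).1
    have hcard' : ((P '' S).ncard : ℝ) + 1 =
        (p '' S).ncard + (q '' (S ∩ p ⁻¹' {i})).ncard := by exact_mod_cast hcard
    simp only [f] at h1
    linarith
  · intro W hWS hW a ha b hb
    by_contra hab
    let P : V → V := fun v => if p v ∈ p '' W then p a else p v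
    have hPW : ∀ v ∈ W, P v = p a := fun v hv => if_pos ⟨v, hv, rfl⟩
    have himg : P '' S = insert (p a) (p '' S \ p '' W) := by
      ext x
      constructor
      · rintro ⟨v, hv, rfl⟩
        by_cases h : p v ∈ p '' W
        · left
          simp only [P, if_pos h]
        · right
          simp only [P, if_neg h]
          exact ⟨⟨v, hv, rfl⟩, h⟩
      · rintro (rfl | ⟨⟨v, hv, rfl⟩, h⟩)
        · exact ⟨a, hWS ha, hPW a ha⟩
        · exact ⟨v, hv, if_neg h⟩
    have hcard : (P '' S).ncard + (p '' W).ncard = (p '' S).ncard + 1 := by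
      rw [himg, Set.ncard_insert_of_notMem (fun h => h.2 ⟨a, ha, rfl⟩)]
      have := Set.ncard_sdiff_add_ncard_of_subset (Set.image_mono (f := p) hWS)
      omega
    have htwo : 2 ≤ (p '' W).ncard := by
      have h2 : ({p a, p b} : Set V) ⊆ p '' W := by
        rintro _ (rfl | rfl)
        exacts [⟨a, ha, rfl⟩, ⟨b, hb, rfl⟩]
      have := Set.ncard_le_ncard h2
      rwa [Set.ncard_pair hab] at this
    have hsum : ∑ e ∈ crossing (insideEdges G S) P, w e +
        ∑ e ∈ crossing (insideEdges G W) p, w e ≤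
        ∑ e ∈ crossing (insideEdges G S) p, w e := by
      rw [← Finset.sum_union]
      · refine Finset.sum_le_sum_of_subset_of_nonneg ?_ fun e he _ => hwS (mem_crossing.1 he).1
        intro e
        induction e using Sym2.ind with
        | _ c d =>
          simp only [mem_crossing, mem_union, mk_mem_insideEdges, Sym2.map_mk,
            Sym2.mk_isDiag_iff]
          rintro (⟨h, hne⟩ | ⟨⟨h, hc, hd⟩, hne⟩)
          · exact ⟨h, fun hcd => hne (by simp only [P, hcd])⟩
          · exact ⟨⟨h, hWS hc, hWS hd⟩, hne⟩
      · rw [Finset.disjoint_left]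
        intro e
        induction e using Sym2.ind with
        | _ c d =>
          simp only [mem_crossing, mk_mem_insideEdges, Sym2.map_mk, Sym2.mk_isDiag_iff]
          rintro ⟨-, hne⟩ ⟨⟨-, hc, hd⟩, -⟩
          exact hne (by rw [hPW c hc, hPW d hd])
    have hcard' : ((P '' S).ncard : ℝ) + (p '' W).ncard = (p '' S).ncard + 1 := by
      exact_mod_cast hcard
    have h1 := hW p
    rcases hmin P with h | ⟨-, h⟩
    · simp only [f] at h
      linarith
    · omega

lemma crossing_antitone {H H' : SimpleGraph V} (hle : H ≤ H') (F : Finset (Sym2 V)) :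
    crossing F H'.connectedComponentMk ⊆ crossing F H.connectedComponentMk := by
  intro e
  induction e using Sym2.ind with
  | _ a b =>
    simp only [mem_crossing, Sym2.map_mk, Sym2.mk_isDiag_iff, SimpleGraph.ConnectedComponent.eq]
    exact fun ⟨h, h'⟩ => ⟨h, fun hr => h' (hr.mono hle)⟩

lemma ncard_components_sup_edge_lt [Finite V] (H : SimpleGraph V) (S : Set V) {a b : V}
    (ha : a ∈ S) (hb : b ∈ S) (hab : ¬ H.Reachable a b) :
    ((H ⊔ SimpleGraph.edge a b).connectedComponentMk '' S).ncard <
      (H.connectedComponentMk '' S).ncard := by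
  set H' := H ⊔ SimpleGraph.edge a b with hH'
  let φ : H →g H' := SimpleGraph.Hom.ofLE le_sup_left
  have himg : H'.connectedComponentMk '' S =
      SimpleGraph.ConnectedComponent.map φ '' (H.connectedComponentMk '' S) := by
    rw [Set.image_image]
    rfl
  rw [himg]
  refine lt_of_le_of_ne Set.ncard_image_le fun h => hab ?_
  have hinj := Set.injOn_of_ncard_image_eq h
  have hne : a ≠ b := fun h => hab (h ▸ SimpleGraph.Reachable.refl a)
  have hadj : H'.Adj a b := Or.inr (by simp [SimpleGraph.edge_adj, hne])
  exact SimpleGraph.ConnectedComponent.eq.1 (hinj ⟨a, ha, rfl⟩ ⟨b, hb, rfl⟩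
    (SimpleGraph.ConnectedComponent.eq.2 hadj.reachable))

/-- Greedy extension of a forest to one connecting `S`, at a cost bounded by the fractional cost
of the edges of `S` that cross the components of the forest. -/
lemma exists_forest_extension [Fintype V] (G : SimpleGraph V) (w : Sym2 V → ℝ)
    (hw : ∀ e ∈ G.edgeSet, 0 ≤ w e) (S : Set V) (hS : S.Nonempty) (hst : IsStrong G w S)
    (H : SimpleGraph V) (hH : H.IsAcyclic) (c : Sym2 V → ℝ)
    (hc : ∀ e ∈ crossing (insideEdges G S) H.connectedComponentMk, 0 ≤ c e) :
    ∃ D : Finset (Sym2 V), D ⊆ insideEdges G S ∧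
      (H ⊔ SimpleGraph.fromEdgeSet (D : Set (Sym2 V))).IsAcyclic ∧
      (∀ u ∈ S, ∀ v ∈ S, (H ⊔ SimpleGraph.fromEdgeSet (D : Set (Sym2 V))).Reachable u v) ∧
      D.card + 1 ≤ (H.connectedComponentMk '' S).ncard ∧
      ∑ e ∈ D, c e ≤ ∑ e ∈ crossing (insideEdges G S) H.connectedComponentMk, c e * w e := by
  induction hn : (H.connectedComponentMk '' S).ncard using Nat.strong_induction_on
    generalizing H c with
  | _ n ih =>
  have hwS : ∀ {K : SimpleGraph V},
      ∀ e ∈ crossing (insideEdges G S) K.connectedComponentMk, 0 ≤ w e := fun e he =>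
    hw _ (mem_edgeSet_of_mem_insideEdges (mem_crossing.1 he).1)
  have hstr := hst.ncard_image_le H.connectedComponentMk
  have hpos : 0 < (H.connectedComponentMk '' S).ncard :=
    (Set.ncard_pos).2 (hS.image _)
  rw [hn] at hstr hpos
  by_cases hone : n = 1
  · refine ⟨∅, by simp, by simpa using hH, ?_, by simp [hone], ?_⟩
    · intro u hu v hv
      obtain ⟨x, hx⟩ := Set.ncard_eq_one.1 (hn.trans hone)
      have hmem : ∀ z ∈ S, H.connectedComponentMk z = x := fun z hz => by
        have : H.connectedComponentMk z ∈ H.connectedComponentMk '' S := ⟨z, hz, rfl⟩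
        rwa [hx] at this
      have := SimpleGraph.ConnectedComponent.eq.1 ((hmem u hu).trans (hmem v hv).symm)
      exact this.mono le_sup_left
    · rw [Finset.sum_empty]
      exact Finset.sum_nonneg fun e he => mul_nonneg (hc e he) (hwS e he)
  · have hne : (crossing (insideEdges G S) H.connectedComponentMk).Nonempty := by
      rw [Finset.nonempty_iff_ne_empty]
      intro h
      rw [h, Finset.sum_empty, zero_add] at hstr
      have : n ≤ 1 := by exact_mod_cast hstr
      omega
    obtain ⟨e₀, he₀, hmin⟩ := Finset.exists_min_image _ c hne
    obtain ⟨m, hm⟩ : ∃ m, m = c e₀ := ⟨_, rfl⟩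
    have hm0 : 0 ≤ m := hm ▸ hc e₀ he₀
    rw [← hm] at hmin
    obtain ⟨a, b, rfl⟩ : ∃ a b, e₀ = s(a, b) := by
      induction e₀ using Sym2.ind with
      | _ a b => exact ⟨a, b, rfl⟩
    have he₀' := mem_crossing.1 he₀
    obtain ⟨hG, ha, hb⟩ := mk_mem_insideEdges.1 he₀'.1
    have hab : ¬ H.Reachable a b := by
      simpa [SimpleGraph.ConnectedComponent.eq] using he₀'.2
    have hlt := ncard_components_sup_edge_lt H S ha hb hab
    have hsub := crossing_antitone (le_sup_left : H ≤ H ⊔ SimpleGraph.edge a b) (insideEdges G S)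
    obtain ⟨D, hDS, hDa, hDr, hDc, hDw⟩ := ih _ (hn ▸ hlt) (H ⊔ SimpleGraph.edge a b)
      (hH.sup_edge_of_not_reachable hab) (fun e => c e - m)
      (fun e he => sub_nonneg.2 (hmin e (hsub he))) rfl
    have hgraph : H ⊔ SimpleGraph.fromEdgeSet ((insert s(a, b) D : Finset (Sym2 V)) : Set (Sym2 V))
        = H ⊔ SimpleGraph.edge a b ⊔ SimpleGraph.fromEdgeSet (D : Set (Sym2 V)) := by
      rw [Finset.coe_insert, Set.insert_eq, SimpleGraph.fromEdgeSet_union, sup_assoc]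
      rfl
    have hcard : (insert s(a, b) D).card + 1 ≤ n := by
      have := Finset.card_insert_le s(a, b) D
      omega
    refine ⟨insert s(a, b) D, Finset.insert_subset he₀'.1 hDS, ?_, ?_, hcard, ?_⟩
    · rwa [hgraph]
    · rwa [hgraph]
    · have h1 : ∑ e ∈ insert s(a, b) D, (c e - m) = ∑ e ∈ D, (c e - m) :=
        Finset.sum_insert_of_eq_zero_if_notMem fun _ => by rw [hm, sub_self]
      have h2 : ∑ e ∈ crossing (insideEdges G S) (H ⊔ SimpleGraph.edge a b).connectedComponentMk,
          (c e - m) * w e ≤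
          ∑ e ∈ crossing (insideEdges G S) H.connectedComponentMk, (c e - m) * w e :=
        Finset.sum_le_sum_of_subset_of_nonneg hsub fun e he _ =>
          mul_nonneg (sub_nonneg.2 (hmin e he)) (hwS e he)
      have h3 : ((insert s(a, b) D).card : ℝ) + 1 ≤ n := by exact_mod_cast hcard
      have h4 : m * ((insert s(a, b) D).card : ℝ) ≤
          m * ∑ e ∈ crossing (insideEdges G S) H.connectedComponentMk, w e :=
        mul_le_mul_of_nonneg_left (by linarith) hm0
      have h5 : ∑ e ∈ insert s(a, b) D, (c e - m) =
          ∑ e ∈ insert s(a, b) D, c e - m * ((insert s(a, b) D).card : ℝ) := by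
        rw [Finset.sum_sub_distrib, Finset.sum_const, nsmul_eq_mul, mul_comm]
      have h6 : ∑ e ∈ crossing (insideEdges G S) H.connectedComponentMk, (c e - m) * w e =
          ∑ e ∈ crossing (insideEdges G S) H.connectedComponentMk, c e * w e -
          m * ∑ e ∈ crossing (insideEdges G S) H.connectedComponentMk, w e := by
        rw [Finset.mul_sum, ← Finset.sum_sub_distrib]
        exact Finset.sum_congr rfl fun e _ => by ring
      linarith

/-- A laminar family of strong sets admits a cheap forest inducing a connected graph on each
member. -/
lemma exists_laminar_forest [Fintype V] (G : SimpleGraph V) (w : Sym2 V → ℝ)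
    (hw : ∀ e ∈ G.edgeSet, 0 ≤ w e) (c : Sym2 V → ℝ) (hc : ∀ e, 0 ≤ c e)
    (F : Finset (Set V)) (hF : Laminar (F : Set (Set V)))
    (hFs : ∀ S ∈ F, S.Nonempty ∧ IsStrong G w S) :
    ∃ H : SimpleGraph V, H ≤ G ∧ H.IsAcyclic ∧
      (∀ u v, H.Adj u v → ∃ S ∈ F, u ∈ S ∧ v ∈ S) ∧
      (∀ S ∈ F, (H.induce S).Connected) ∧
      ∑ e ∈ graphEdges H, c e +
        ∑ e ∈ crossing (insideEdges G Set.univ) H.connectedComponentMk, c e * w e ≤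
        ∑ e ∈ insideEdges G Set.univ, c e * w e := by
  induction F using Finset.induction_on_max_value (fun S : Set V => S.ncard) with
  | empty =>
    refine ⟨⊥, bot_le, SimpleGraph.isAcyclic_bot, by simp, by simp, ?_⟩
    simp only [graphEdges, SimpleGraph.edgeSet_bot, Set.mem_empty_iff_false, Finset.filter_false,
      Finset.sum_empty, zero_add]
    refine Finset.sum_le_sum_of_subset_of_nonneg (Finset.filter_subset _ _) fun e he _ => ?_
    exact mul_nonneg (hc e) (hw e (mem_edgeSet_of_mem_insideEdges he))
  | insert S F hSF hmax ih =>
    obtain ⟨H, hHG, hHa, hHF, hHc, hHw⟩ := ih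
      (fun A B hA hB => hF A B (by simp_all) (by simp_all))
      (fun A hA => hFs A (mem_insert_of_mem hA))
    obtain ⟨hSne, hSs⟩ := hFs S (mem_insert_self _ _)
    obtain ⟨D, hDS, hDa, hDr, -, hDw⟩ := exists_forest_extension G w hw S hSne hSs H hHa c
      (fun e _ => hc e)
    set T := H ⊔ SimpleGraph.fromEdgeSet (D : Set (Sym2 V)) with hT
    have hDadj : ∀ u v, s(u, v) ∈ D → G.Adj u v ∧ u ∈ S ∧ v ∈ S := fun u v h =>
      mk_mem_insideEdges.1 (hDS h)
    have hHT : H ≤ T := le_sup_left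
    have hclosed : ∀ u v, T.Adj u v → u ∈ S → v ∈ S := by
      rintro u v (h | h) hu
      · obtain ⟨A, hA, huA, hvA⟩ := hHF u v h
        rcases hF S A (by simp) (by simp [hA]) with h0 | h0 | h0
        · exact absurd (h0 ▸ ⟨hu, huA⟩ : u ∈ (∅ : Set V)) (Set.notMem_empty u)
        · have : S = A := Set.eq_of_subset_of_ncard_le (Set.inter_eq_left.1 h0) (hmax A hA)
          exact this ▸ hvA
        · exact Set.inter_eq_right.1 h0 hvA
      · exact (hDadj u v ((SimpleGraph.fromEdgeSet_adj _).1 h).1).2.2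
    refine ⟨T, ?_, hDa, ?_, ?_, ?_⟩
    · refine sup_le hHG fun u v h => ?_
      exact (hDadj u v ((SimpleGraph.fromEdgeSet_adj _).1 h).1).1
    · rintro u v (h | h)
      · obtain ⟨A, hA, h'⟩ := hHF u v h
        exact ⟨A, mem_insert_of_mem hA, h'⟩
      · exact ⟨S, mem_insert_self _ _, (hDadj u v ((SimpleGraph.fromEdgeSet_adj _).1 h).1).2⟩
    · intro A hA
      rcases mem_insert.1 hA with rfl | hA
      · have hwalk : ∀ u v (p : T.Walk u v) (hu : u ∈ A),
            ∃ hv : v ∈ A, (T.induce A).Reachable ⟨u, hu⟩ ⟨v, hv⟩ := by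
          intro u v p
          induction p with
          | nil => exact fun hu => ⟨hu, SimpleGraph.Reachable.refl _⟩
          | cons h p ihp =>
            intro hu
            obtain ⟨hv, hr⟩ := ihp (hclosed _ _ h hu)
            refine ⟨hv, SimpleGraph.Reachable.trans (SimpleGraph.Adj.reachable ?_) hr⟩
            exact h
        obtain ⟨s, hs⟩ := hSne
        have : Nonempty A := ⟨⟨s, hs⟩⟩
        refine SimpleGraph.Connected.mk fun u v => ?_
        obtain ⟨p⟩ := hDr u u.2 v v.2
        exact (hwalk u v p u.2).2
      · exact (hHc A hA).mono fun u v h => hHT h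
    · have h1 : ∑ e ∈ graphEdges T, c e ≤ ∑ e ∈ graphEdges H, c e + ∑ e ∈ D, c e := by
        rw [← Finset.sum_union_inter]
        refine le_add_of_le_of_nonneg ?_ (Finset.sum_nonneg fun e _ => hc e)
        refine Finset.sum_le_sum_of_subset_of_nonneg ?_ fun e _ _ => hc e
        intro e
        simp only [hT, mem_graphEdges, mem_union, SimpleGraph.edgeSet_sup,
          SimpleGraph.edgeSet_fromEdgeSet, Set.mem_union, Set.mem_sdiff, mem_coe]
        tauto
      have h2 : ∑ e ∈ crossing (insideEdges G Set.univ) T.connectedComponentMk, c e * w e +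
          ∑ e ∈ crossing (insideEdges G S) H.connectedComponentMk, c e * w e ≤
          ∑ e ∈ crossing (insideEdges G Set.univ) H.connectedComponentMk, c e * w e := by
        rw [← Finset.sum_union]
        · refine Finset.sum_le_sum_of_subset_of_nonneg (union_subset (crossing_antitone hHT _) ?_)
            fun e he _ => mul_nonneg (hc e)
              (hw e (mem_edgeSet_of_mem_insideEdges (mem_crossing.1 he).1))
          refine Finset.filter_subset_filter _ fun e he => ?_
          simp only [insideEdges, mem_filter] at he ⊢
          exact ⟨he.1, he.2.1, fun _ _ => Set.mem_univ _⟩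
        · rw [Finset.disjoint_left]
          intro e
          induction e using Sym2.ind with
          | _ u v =>
            simp only [mem_crossing, mk_mem_insideEdges, Sym2.map_mk, Sym2.mk_isDiag_iff,
              SimpleGraph.ConnectedComponent.eq]
            rintro ⟨-, h⟩ ⟨⟨-, hu, hv⟩, -⟩
            exact h (hDr u hu v hv)
      linarith

/-- If every nonnegative cost vector has a point of the finite set `A` of cost at most that
of `w`, then `w` dominates a convex combination of points of `A`. -/
lemma exists_mem_convexHull_le {ι : Type*} [Fintype ι] {A : Set (ι → ℝ)} (hA : A.Finite)
    (w : ι → ℝ)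
    (h : ∀ c : ι → ℝ, (∀ e, 0 ≤ c e) → ∃ a ∈ A, ∑ e, c e * a e ≤ ∑ e, c e * w e) :
    ∃ y ∈ convexHull ℝ A, ∀ e, y e ≤ w e := by
  by_contra! hcon
  have hdisj : Disjoint (convexHull ℝ A) (Set.Iic w) := by
    rw [Set.disjoint_left]
    intro y hy hyw
    obtain ⟨e, he⟩ := hcon y hy
    exact absurd (hyw e) (not_le.2 he)
  obtain ⟨f, u, v, hfu, huv, hfv⟩ := geometric_hahn_banach_compact_closed (convex_convexHull ℝ A)
    (hA.isCompact_convexHull ℝ) (convex_Iic w) isClosed_Iic hdisj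
  have hf : ∀ y, f y = ∑ e, f (Pi.single e 1) * y e := fun y => by
    conv_lhs => rw [pi_eq_sum_univ' y]
    rw [map_sum]
    refine Finset.sum_congr rfl fun e _ => ?_
    rw [map_smul, smul_eq_mul, mul_comm]
  have hneg : ∀ e, f (Pi.single e 1) ≤ 0 := by
    intro e
    by_contra! hpos
    obtain ⟨t, ht⟩ : ∃ t, t = (|f w - v| + 1) / f (Pi.single e 1) := ⟨_, rfl⟩
    have ht0 : 0 ≤ t := ht ▸ by positivity
    have hmem : w - t • Pi.single e (1 : ℝ) ∈ Set.Iic w := by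
      refine sub_le_self w (smul_nonneg ht0 ?_)
      exact Pi.single_nonneg.2 zero_le_one
    have h1 := hfv _ hmem
    rw [map_sub, map_smul, smul_eq_mul, ht, div_mul_cancel₀ _ hpos.ne'] at h1
    have := le_abs_self (f w - v)
    linarith
  obtain ⟨a, ha, hle⟩ := h (fun e => -f (Pi.single e 1)) fun e => neg_nonneg.2 (hneg e)
  simp only [neg_mul, Finset.sum_neg_distrib, ← hf] at hle
  have h1 := hfu a (subset_convexHull ℝ A ha)
  have h2 := hfv w (Set.mem_Iic.2 le_rfl)
  linarith

/-- Contracting the classes of `p` in a connected graph leaves a connected graph. -/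
lemma SimpleGraph.Connected.ncard_range_le [Fintype V] {T : SimpleGraph V} (hT : T.Connected)
    {ι : Type*} (p : V → ι) :
    (Set.range p).ncard ≤ (crossing (graphEdges T) p).card + 1 := by
  let Q : SimpleGraph (Set.range p) :=
    { Adj := fun x y => x ≠ y ∧ ∃ u v, T.Adj u v ∧ p u = x ∧ p v = y
      symm := ⟨fun x y ⟨hne, u, v, h, hu, hv⟩ => ⟨hne.symm, v, u, h.symm, hv, hu⟩⟩
      loopless := ⟨fun x h => h.1 rfl⟩ }
  have hwalk : ∀ u v (_ : T.Walk u v), Q.Reachable ⟨p u, u, rfl⟩ ⟨p v, v, rfl⟩ := by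
    intro u v q
    induction q with
    | nil => exact SimpleGraph.Reachable.refl _
    | @cons a b c hab q ih =>
      refine SimpleGraph.Reachable.trans ?_ ih
      by_cases hpab : p a = p b
      · simp only [hpab]
        exact SimpleGraph.Reachable.refl _
      · exact SimpleGraph.Adj.reachable
          ⟨fun h => hpab (Subtype.ext_iff.1 h), a, b, hab, rfl, rfl⟩
  have hQ : Q.Connected := by
    obtain ⟨v⟩ := hT.nonempty
    have : Nonempty (Set.range p) := ⟨⟨p v, v, rfl⟩⟩
    refine SimpleGraph.Connected.mk ?_
    rintro ⟨_, a, rfl⟩ ⟨_, b, rfl⟩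
    obtain ⟨q⟩ := hT.preconnected a b
    exact hwalk a b q
  have h1 := hQ.card_vert_le_card_edgeSet_add_one
  rw [Nat.card_coe_set_eq, Nat.card_coe_set_eq] at h1
  refine h1.trans (Nat.add_le_add_right ?_ 1)
  rw [← Set.ncard_image_of_injective Q.edgeSet (Sym2.map.injective Subtype.val_injective),
    ← Set.ncard_coe_finset]
  refine le_trans (Set.ncard_le_ncard ?_ (Set.toFinite _)) (Set.ncard_image_le (f := Sym2.map p))
  rintro _ ⟨e, he, rfl⟩
  induction e using Sym2.ind with
  | _ x y =>
    obtain ⟨hne, u, v, huv, hu, hv⟩ := he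
    refine ⟨s(u, v), ?_, by simp [hu, hv]⟩
    have : p u ≠ p v := fun h => hne (Subtype.ext (by rw [← hu, ← hv, h]))
    simpa [mem_crossing, mem_graphEdges, huv] using this

lemma nonneg_of_mem_stPolytope [Fintype V] {G : SimpleGraph V} {x : Sym2 V → ℝ}
    (hx : x ∈ stPolytope G) (e : Sym2 V) : 0 ≤ x e := by
  have : stPolytope G ⊆ Set.Ici 0 := by
    refine convexHull_min ?_ (convex_Ici 0)
    rintro _ ⟨T, -, -, rfl⟩ e
    simp only [Pi.zero_apply]
    split_ifs <;> norm_num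
  exact this hx e

lemma isStrong_univ_of_mem_stPolytope [Fintype V] {G : SimpleGraph V} {x : Sym2 V → ℝ}
    (hx : x ∈ stPolytope G) : IsStrong G x Set.univ := by
  intro p
  have : stPolytope G ⊆ {y | ((p '' Set.univ).ncard : ℝ) ≤
      ∑ e ∈ crossing (insideEdges G Set.univ) p, y e + 1} := by
    refine convexHull_min ?_ ?_
    · rintro _ ⟨T, hTG, hT, rfl⟩
      have h := hT.connected.ncard_range_le p
      rw [Set.mem_ofPred_eq, Finset.sum_boole, Set.image_univ]
      have hset : (crossing (insideEdges G Set.univ) p).filter (fun e => e ∈ T.edgeSet) =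
          crossing (graphEdges T) p := by
        ext e
        induction e using Sym2.ind with
        | _ a b =>
          simp only [mem_filter, mem_crossing, mk_mem_insideEdges, mem_graphEdges,
            SimpleGraph.mem_edgeSet, Set.mem_univ, and_true]
          have := @hTG a b
          tauto
      rw [hset]
      exact_mod_cast h
    · intro y hy z hz a b ha hb hab
      simp only [Set.mem_ofPred_eq, Pi.add_apply, Pi.smul_apply, smul_eq_mul,
        Finset.sum_add_distrib, ← Finset.mul_sum] at *
      calc ((p '' Set.univ).ncard : ℝ)
          = a * (p '' Set.univ).ncard + b * (p '' Set.univ).ncard := by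
            rw [← add_mul, hab, one_mul]
        _ ≤ a * (∑ e ∈ crossing (insideEdges G Set.univ) p, y e + 1) +
            b * (∑ e ∈ crossing (insideEdges G Set.univ) p, z e + 1) :=
          add_le_add (mul_le_mul_of_nonneg_left hy ha) (mul_le_mul_of_nonneg_left hz hb)
        _ = _ := by linear_combination hab
  exact this hx

lemma one_le_sum_cutEdges [Fintype V] {G : SimpleGraph V} {x : Sym2 V → ℝ}
    (hx : x ∈ stPolytope G) {S : Set V} (hS : S.Nonempty) (hS' : S ≠ Set.univ) :
    1 ≤ ∑ e ∈ cutEdges G S, x e := by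
  have h := (isStrong_univ_of_mem_stPolytope hx).ncard_image_le (fun v => v ∈ S)
  have h1 : crossing (insideEdges G Set.univ) (fun v => v ∈ S) = cutEdges G S := by
    ext e
    induction e using Sym2.ind with
    | _ a b =>
      simp only [mem_crossing, mk_mem_insideEdges, mk_mem_cutEdges, Sym2.map_mk,
        Sym2.mk_isDiag_iff, Set.mem_univ, and_true, eq_iff_iff]
      tauto
  have h2 : 2 ≤ ((fun v => v ∈ S) '' Set.univ).ncard := by
    obtain ⟨a, ha⟩ := hS
    obtain ⟨b, hb⟩ := (Set.ne_univ_iff_exists_notMem S).1 hS'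
    have hsub : ({True, False} : Set Prop) ⊆ (fun v => v ∈ S) '' Set.univ := by
      rintro _ (rfl | rfl)
      · exact ⟨a, trivial, by simp [ha]⟩
      · exact ⟨b, trivial, by simp [hb]⟩
    have := Set.ncard_le_ncard hsub
    rwa [Set.ncard_pair true_ne_false] at this
  rw [h1] at h
  have h2' : (2 : ℝ) ≤ ((fun v => v ∈ S) '' Set.univ).ncard := by exact_mod_cast h2
  linarith

lemma card_inter_cutEdges_le [Fintype V] (G : SimpleGraph V) (F : Finset (Sym2 V)) (S : Set V)
    (p : V → V) :
    (F ∩ cutEdges G S).card ≤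
      ∑ i ∈ (p '' S).toFinset, (F ∩ cutEdges G (S ∩ p ⁻¹' {i})).card := by
  refine le_trans (Finset.card_le_card ?_) Finset.card_biUnion_le
  intro e
  induction e using Sym2.ind with
  | _ a b =>
    simp only [mem_inter, mem_biUnion, Set.mem_toFinset, mk_mem_cutEdges, Set.mem_inter_iff,
      Set.mem_preimage, Set.mem_singleton_iff]
    rintro ⟨hF, hG, (⟨ha, hb⟩ | ⟨hb, ha⟩)⟩
    · exact ⟨p a, ⟨a, ha, rfl⟩, hF, hG, by tauto⟩
    · exact ⟨p b, ⟨b, hb, rfl⟩, hF, hG, by tauto⟩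

lemma sum_cutEdges_parts_le [Fintype V] (G : SimpleGraph V) (x : Sym2 V → ℝ)
    (hx : ∀ e, 0 ≤ x e) (S : Set V) (p : V → V) :
    ∑ i ∈ (p '' S).toFinset, ∑ e ∈ cutEdges G (S ∩ p ⁻¹' {i}), x e ≤
      ∑ e ∈ cutEdges G S, x e + 2 * ∑ e ∈ crossing (insideEdges G S) p, x e := by
  have hite : ∀ F : Finset (Sym2 V), ∑ e ∈ F, x e = ∑ e, if e ∈ F then x e else 0 := fun F => by
    rw [← Finset.sum_filter]
    exact Finset.sum_congr (by ext; simp) fun _ _ => rfl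
  simp only [hite]
  rw [Finset.sum_comm, Finset.mul_sum, ← Finset.sum_add_distrib]
  refine Finset.sum_le_sum fun e _ => ?_
  rw [← Finset.sum_filter, Finset.sum_const, nsmul_eq_mul]
  have hxe := hx e
  have key : ∀ (J : Finset V) (k : ℕ),
      (p '' S).toFinset.filter (fun i => e ∈ cutEdges G (S ∩ p ⁻¹' {i})) ⊆ J → J.card ≤ k →
      (((p '' S).toFinset.filter (fun i => e ∈ cutEdges G (S ∩ p ⁻¹' {i}))).card : ℝ) * x e ≤
        k * x e := fun J k h1 h2 =>
    mul_le_mul_of_nonneg_right (by exact_mod_cast (Finset.card_le_card h1).trans h2) hxe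
  induction e using Sym2.ind with
  | _ a b =>
    by_cases hcut : s(a, b) ∈ cutEdges G S
    · have hcr : s(a, b) ∉ crossing (insideEdges G S) p := by
        simp only [mk_mem_cutEdges, mem_crossing, mk_mem_insideEdges] at hcut ⊢
        tauto
      rw [if_pos hcut, if_neg hcr, mul_zero, add_zero]
      refine (key {if a ∈ S then p a else p b} 1 ?_ (by simp)).trans (by simp)
      intro i
      simp only [mk_mem_cutEdges, mem_filter, Set.mem_inter_iff, Set.mem_preimage,
        Set.mem_singleton_iff, mem_singleton] at hcut ⊢
      by_cases ha : a ∈ S <;> simp only [ha, if_true, if_false] <;> grind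
    · rw [if_neg hcut, zero_add]
      by_cases hcr : s(a, b) ∈ crossing (insideEdges G S) p
      · rw [if_pos hcr]
        refine (key {p a, p b} 2 ?_ Finset.card_le_two).trans (by simp)
        intro i
        simp only [mk_mem_cutEdges, mem_filter, Set.mem_inter_iff, Set.mem_preimage,
          Set.mem_singleton_iff, mem_singleton, mem_insert]
        grind
      · rw [if_neg hcr, mul_zero]
        refine (key ∅ 0 ?_ (by simp)).trans (by simp)
        intro i
        simp only [mk_mem_cutEdges, mem_filter, Set.mem_inter_iff, Set.mem_preimage,
          Set.mem_singleton_iff, mem_crossing, mk_mem_insideEdges, Sym2.map_mk,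
          Sym2.mk_isDiag_iff] at hcut hcr ⊢
        grind

/-- A laminar family of strong sets containing the whole vertex set admits an aligned point of the
spanning tree polytope dominated by the weights. -/
lemma exists_aligned_le [Fintype V] (G : SimpleGraph V) (w : Sym2 V → ℝ)
    (hw : ∀ e ∈ G.edgeSet, 0 ≤ w e) (L : Set (Set V)) (hL : Laminar L)
    (hLs : ∀ S ∈ L, S.Nonempty ∧ IsStrong G w S) (huniv : Set.univ ∈ L) :
    ∃ y ∈ stPolytope G, IsAligned G L y ∧ ∀ e ∈ G.edgeSet, y e ≤ w e := by
  let A : Set (Sym2 V → ℝ) := {y | ∃ T : SimpleGraph V, T ≤ G ∧ T.IsTree ∧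
    (∀ S ∈ L, (T.induce S).Connected) ∧ y = fun e => if e ∈ T.edgeSet then (1 : ℝ) else 0}
  have hA : A.Finite := by
    refine (Set.finite_range
      (fun (T : SimpleGraph V) (e : Sym2 V) => if e ∈ T.edgeSet then (1 : ℝ) else 0)).subset ?_
    rintro _ ⟨T, -, -, -, rfl⟩
    exact ⟨T, rfl⟩
  obtain ⟨y, hy, hyw⟩ := exists_mem_convexHull_le hA
    (fun e => if e ∈ G.edgeSet then w e else 0) (fun c hc => by
      obtain ⟨T, hTG, hTa, -, hTc, hTw⟩ := exists_laminar_forest G w hw c hc L.toFinset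
        (by simpa using hL) (by simpa using hLs)
      refine ⟨_, ⟨T, hTG, ⟨?_, hTa⟩, fun S hS => hTc S (by simpa using hS), rfl⟩, ?_⟩
      · have h := hTc Set.univ (by simpa using huniv)
        exact (SimpleGraph.induceUnivIso T).connected_iff.1 h
      · have h1 : ∑ e, c e * (if e ∈ T.edgeSet then (1 : ℝ) else 0) =
            ∑ e ∈ graphEdges T, c e := by
          simp only [mul_ite, mul_one, mul_zero, ← Finset.sum_filter]
          exact Finset.sum_congr (by ext; simp [mem_graphEdges]) fun _ _ => rfl
        have h2 : ∑ e, c e * (if e ∈ G.edgeSet then w e else 0) =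
            ∑ e ∈ insideEdges G Set.univ, c e * w e := by
          simp only [mul_ite, mul_zero, ← Finset.sum_filter]
          exact Finset.sum_congr (by ext; simp [insideEdges]) fun _ _ => rfl
        rw [h1, h2]
        refine le_trans (le_add_of_nonneg_right (Finset.sum_nonneg fun e he => ?_)) hTw
        exact mul_nonneg (hc e) (hw e (mem_edgeSet_of_mem_insideEdges (mem_crossing.1 he).1)))
  refine ⟨y, ?_, ?_, fun e he => by simpa [he] using hyw e⟩
  · refine convexHull_mono ?_ hy
    rintro _ ⟨T, hTG, hT, -, rfl⟩
    exact ⟨T, hTG, hT, rfl⟩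
  · intro S hS
    let R : (Sym2 V → ℝ) →ₗ[ℝ] (Sym2 S → ℝ) := LinearMap.funLeft ℝ ℝ (Sym2.map Subtype.val)
    have h1 : R y ∈ convexHull ℝ (R '' A) := by
      rw [← LinearMap.image_convexHull]
      exact ⟨y, hy, rfl⟩
    refine convexHull_mono ?_ h1
    rintro _ ⟨_, ⟨T, hTG, hT, hTc, rfl⟩, rfl⟩
    refine ⟨T.induce S, fun u v h => hTG h, ⟨hTc S hS, hT.isAcyclic.induce S⟩, ?_⟩
    funext e
    induction e using Sym2.ind with
    | _ u v => simp [R, LinearMap.funLeft_apply]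

/-- The partition bound behind the reduction: crossing weights of a good partition of `S` bound
the total boundary of its classes. -/
lemma sum_cutEdges_parts_le_of_partition [Fintype V] {G : SimpleGraph V} {x : Sym2 V → ℝ}
    (hx : x ∈ stPolytope G) {η : ℝ} (hη : 2 < η) {S : Set V} (hS : S ≠ Set.univ) {p : V → V}
    (hp : ∑ e ∈ crossing (insideEdges G S) p, η * x e + 1 ≤ ((p '' S).ncard : ℝ)) :
    ((p '' S).ncard : ℝ) ≤
        ∑ i ∈ (p '' S).toFinset, ∑ e ∈ cutEdges G (S ∩ p ⁻¹' {i}), x e ∧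
      ∑ i ∈ (p '' S).toFinset, ∑ e ∈ cutEdges G (S ∩ p ⁻¹' {i}), x e ≤
        1 / (1 - 2 / η) * ∑ e ∈ cutEdges G S, x e := by
  have hk : ((p '' S).ncard : ℝ) ≤
      ∑ i ∈ (p '' S).toFinset, ∑ e ∈ cutEdges G (S ∩ p ⁻¹' {i}), x e := by
    rw [Set.ncard_eq_toFinset_card', Finset.card_eq_sum_ones, Nat.cast_sum]
    refine Finset.sum_le_sum fun i hi => ?_
    obtain ⟨v, hv, rfl⟩ := Set.mem_toFinset.1 hi
    rw [Nat.cast_one]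
    refine one_le_sum_cutEdges hx ⟨v, hv, rfl⟩ fun h => hS ?_
    exact Set.eq_univ_of_univ_subset (h ▸ Set.inter_subset_left)
  refine ⟨hk, ?_⟩
  have h1 := sum_cutEdges_parts_le G x (nonneg_of_mem_stPolytope hx) S p
  rw [← Finset.mul_sum] at hp
  have hη0 : 0 < η := by linarith
  have hpos : 0 < 1 - 2 / η := by
    rw [sub_pos, div_lt_one hη0]
    exact hη
  rw [one_div, inv_mul_eq_div, le_div_iff₀ hpos]
  have h2 : ∑ e ∈ crossing (insideEdges G S) p, x e ≤
      (∑ i ∈ (p '' S).toFinset, ∑ e ∈ cutEdges G (S ∩ p ⁻¹' {i}), x e) / η := by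
    rw [le_div_iff₀ hη0]
    linarith
  rw [mul_sub, mul_one, mul_div_assoc', mul_comm _ (2 : ℝ), mul_div_assoc]
  linarith

/-- Reduction to `L`-aligned points. -/
theorem reduction_to_aligned [Fintype V] (G : SimpleGraph V) (hG : G.Connected)
    (L : Set (Set V)) (hL : Laminar L) (hLne : ∀ S ∈ L, S.Nonempty)
    (x : Sym2 V → ℝ) (hx : x ∈ stPolytope G)
    (η : ℝ) (hη : 2 < η) :
    ∃ (L' : Set (Set V)) (x' : Sym2 V → ℝ),
      Laminar L' ∧ (∀ S ∈ L', S.Nonempty) ∧ x' ∈ stPolytope G ∧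
      IsAligned G L' x' ∧
      (∀ e ∈ G.edgeSet, x' e ≤ η * x e) ∧
      (∀ T : SimpleGraph V, T ≤ G → T.IsTree →
        ∀ α β : ℝ, 0 ≤ α → 0 ≤ β →
        (∀ S ∈ L', ((T.edgeFinset ∩ cutEdges G S).card : ℝ) ≤
            α * (∑ e ∈ cutEdges G S, x' e) + β) →
        ∀ S ∈ L, ((T.edgeFinset ∩ cutEdges G S).card : ℝ) ≤
            (1 / (1 - 2 / η)) * (η * α + β) * ∑ e ∈ cutEdges G S, x e) := by
  have hx0 := nonneg_of_mem_stPolytope hx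
  have hη0 : 0 < η := by linarith
  have hw : ∀ e ∈ G.edgeSet, 0 ≤ η * x e := fun e _ => mul_nonneg hη0.le (hx0 e)
  have hstrong : IsStrong G (fun e => η * x e) Set.univ := by
    refine fun q => (isStrong_univ_of_mem_stPolytope hx q).trans ?_
    refine add_le_add (Finset.sum_le_sum fun e _ => ?_) le_rfl
    exact le_mul_of_one_le_left (hx0 e) (by linarith)
  have : Nonempty V := hG.nonempty
  choose! p hp1 hp2 hp3 using fun (S : Set V) (hS : S ∈ L) =>
    exists_strong_partition G (fun e => η * x e) hw S (hLne S hS)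
  let L' : Set (Set V) :=
    insert Set.univ {W | ∃ S ∈ L, ∃ i ∈ p S '' S, W = S ∩ p S ⁻¹' {i}}
  have hL's : ∀ W ∈ L', W.Nonempty ∧ IsStrong G (fun e => η * x e) W := by
    rintro _ (rfl | ⟨S, hS, _, ⟨v, hv, rfl⟩, rfl⟩)
    · obtain ⟨v⟩ := hG.nonempty
      exact ⟨⟨v, trivial⟩, hstrong⟩
    · exact ⟨⟨v, hv, rfl⟩, hp2 S hS _ ⟨v, hv, rfl⟩⟩
  have hnest : ∀ W, IsStrong G (fun e => η * x e) W → ∀ S ∈ L, W ⊆ S → ∀ i,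
      W ∩ (S ∩ p S ⁻¹' {i}) = ∅ ∨ W ∩ (S ∩ p S ⁻¹' {i}) = W := by
    intro W hW S hS hWS i
    rcases Set.eq_empty_or_nonempty (W ∩ (S ∩ p S ⁻¹' {i})) with h | ⟨a, haW, -, hai⟩
    · exact Or.inl h
    · refine Or.inr (Set.inter_eq_left.2 fun b hb => ⟨hWS hb, ?_⟩)
      exact (hp3 S hS W hWS hW b hb a haW).trans hai
  have hL'lam : Laminar L' := by
    intro A B hA hB
    have hAs := (hL's A hA).2
    have hBs := (hL's B hB).2
    rcases hA with rfl | ⟨S, hS, i, hi, rfl⟩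
    · exact Or.inr (Or.inr (Set.univ_inter B))
    rcases hB with rfl | ⟨S', hS', j, hj, rfl⟩
    · exact Or.inr (Or.inl (Set.inter_univ _))
    rcases hL S S' hS hS' with h | h | h
    · left
      refine Set.eq_empty_of_subset_empty fun v hv => ?_
      rw [← h]
      exact ⟨hv.1.1, hv.2.1⟩
    · rcases hnest _ hAs S' hS'
        (Set.inter_subset_left.trans (Set.inter_eq_left.1 h)) j with h' | h'
      exacts [Or.inl h', Or.inr (Or.inl h')]
    · rcases hnest _ hBs S hS
        (Set.inter_subset_left.trans (Set.inter_eq_right.1 h)) i with h' | h'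
      · exact Or.inl (by rwa [Set.inter_comm])
      · exact Or.inr (Or.inr (by rwa [Set.inter_comm]))
  obtain ⟨y, hy, hyL, hyw⟩ := exists_aligned_le G _ hw L' hL'lam hL's (Set.mem_insert _ _)
  refine ⟨L', y, hL'lam, fun W hW => (hL's W hW).1, hy, hyL, hyw, ?_⟩
  intro T _ _ α β hα hβ hT S hS
  by_cases hSu : S = Set.univ
  · have hcut : cutEdges G S = ∅ := by
      ext e
      simp [hSu, cutEdges]
    simp [hcut]
  obtain ⟨hk, hA⟩ := sum_cutEdges_parts_le_of_partition hx hη hSu (hp1 S hS)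
  have hcard := card_inter_cutEdges_le G T.edgeFinset S (p S)
  calc ((T.edgeFinset ∩ cutEdges G S).card : ℝ)
      ≤ ∑ i ∈ (p S '' S).toFinset,
          ((T.edgeFinset ∩ cutEdges G (S ∩ p S ⁻¹' {i})).card : ℝ) := by exact_mod_cast hcard
    _ ≤ ∑ i ∈ (p S '' S).toFinset,
          (α * (η * ∑ e ∈ cutEdges G (S ∩ p S ⁻¹' {i}), x e) + β) := by
        refine Finset.sum_le_sum fun i hi => ?_
        refine (hT _ (Or.inr ⟨S, hS, i, Set.mem_toFinset.1 hi, rfl⟩)).trans ?_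
        refine add_le_add (mul_le_mul_of_nonneg_left ?_ hα) le_rfl
        rw [Finset.mul_sum]
        exact Finset.sum_le_sum fun e he => hyw e (mem_edgeSet_of_mem_cutEdges he)
    _ = η * α * ∑ i ∈ (p S '' S).toFinset, ∑ e ∈ cutEdges G (S ∩ p S ⁻¹' {i}), x e +
          β * ((p S '' S).ncard : ℝ) := by
        rw [Finset.sum_add_distrib, Finset.sum_const, nsmul_eq_mul,
          ← Set.ncard_eq_toFinset_card', ← Finset.mul_sum, ← Finset.mul_sum]
        ring
    _ ≤ (η * α + β) *
          ∑ i ∈ (p S '' S).toFinset, ∑ e ∈ cutEdges G (S ∩ p S ⁻¹' {i}), x e := by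
        rw [add_mul]
        exact add_le_add le_rfl (mul_le_mul_of_nonneg_left hk hβ)
    _ ≤ (η * α + β) * (1 / (1 - 2 / η) * ∑ e ∈ cutEdges G S, x e) :=
        mul_le_mul_of_nonneg_left hA (by positivity)
    _ = (1 / (1 - 2 / η)) * (η * α + β) * ∑ e ∈ cutEdges G S, x e := by ring
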